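/- Let A and B be graded-commutative algebras of finite type over Q and r ≥ 2 an integer. Then the kernel of the r-fold multiplication map of the graded tensor product A ⊗ B satisfies ker μ^r_{A⊗B} = (ker μ^r_A) ⊗ B^{⊗r} + A^{⊗r} ⊗ (ker μ^r_B), where μ^r_C: C^{⊗r} → C denotes the r-fold multiplication of a graded algebra C and (A⊗B)^{⊗r} is identified with A^{⊗r} ⊗ B^{⊗r}. -/

import Mathlib

noncomputable section

namespace RHT

/-- A graded-commutative algebra over `ℚ`, graded by `ℕ`. -/
class GCA (A : Type) extends Ring A, Algebra ℚ A where
  grading : ℕ → Submodule ℚ A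
  gradedAlgebra : GradedAlgebra grading
  grading_comm : ∀ (i j : ℕ) (a b : A), a ∈ grading i → b ∈ grading j →
    a * b = ((-1 : ℚ) ^ (i * j)) • (b * a)

/-- The grading of a graded-commutative algebra, with the algebra explicit. -/
def Grc (A : Type) [GCA A] : ℕ → Submodule ℚ A := GCA.grading

/-- Morphisms of graded algebras: `ℚ`-algebra morphisms preserving the
grading. -/
def IsGCAHom {A B : Type} [GCA A] [GCA B] (f : A →ₐ[ℚ] B) : Prop :=
  ∀ (i : ℕ) (a : A), a ∈ Grc A i → f a ∈ Grc B i

theorem isGCAHom_id (A : Type) [GCA A] : IsGCAHom (AlgHom.id ℚ A) :=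
  fun _ _ h => h

/-- `A` is of finite type: each graded piece is finite-dimensional. -/
def FiniteType (A : Type) [GCA A] : Prop :=
  ∀ n, FiniteDimensional ℚ (Grc A n)

/-- `T`, together with the morphisms `ι j : A → T`, is the `r`-fold graded
tensor power of `A`, characterized as the `r`-fold coproduct of copies of `A`
in the category of graded-commutative algebras. -/
structure GTensorPower (A : Type) [GCA A] (r : ℕ) (T : Type) [GCA T] where
  ι : Fin r → (A →ₐ[ℚ] T)
  ι_hom : ∀ j, IsGCAHom (ι j)
  coprod : ∀ (B : Type) [GCA B] (f : Fin r → (A →ₐ[ℚ] B)), (∀ j, IsGCAHom (f j)) →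
    ∃! g : T →ₐ[ℚ] B, IsGCAHom g ∧ ∀ j, g.comp (ι j) = f j

/-- The `r`-fold multiplication morphism `μ^r : A^{⊗ r} → A` (the fold map of
the coproduct). -/
noncomputable def GTensorPower.mu {A : Type} [GCA A] {r : ℕ} {T : Type} [GCA T]
    (TP : GTensorPower A r T) : T →ₐ[ℚ] A :=
  (TP.coprod A (fun _ => AlgHom.id ℚ A) (fun _ => isGCAHom_id A)).choose

/-- `C`, with the morphisms `inl : A → C` and `inr : B → C`, is the graded
tensor product `A ⊗ B`, characterized as the coproduct of `A` and `B` in the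
category of graded-commutative algebras. -/
structure GCACoprod (A B C : Type) [GCA A] [GCA B] [GCA C] where
  inl : A →ₐ[ℚ] C
  inr : B →ₐ[ℚ] C
  inl_hom : IsGCAHom inl
  inr_hom : IsGCAHom inr
  coprod : ∀ (D : Type) [GCA D] (f : A →ₐ[ℚ] D) (g : B →ₐ[ℚ] D),
    IsGCAHom f → IsGCAHom g →
    ∃! h : C →ₐ[ℚ] D, IsGCAHom h ∧ h.comp inl = f ∧ h.comp inr = g

section Grading

variable {T U : Type} [GCA T] [GCA U]

instance : GradedAlgebra (Grc T) := GCA.gradedAlgebra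

/-- The projection of a graded-commutative algebra onto its degree `i` part. -/
def proj (T : Type) [GCA T] (i : ℕ) : T →ₗ[ℚ] T :=
  (Grc T i).subtype ∘ₗ DirectSum.component ℚ ℕ (fun i => Grc T i) i ∘ₗ
    (DirectSum.decomposeLinearEquiv (Grc T)).toLinearMap

theorem proj_mem (i : ℕ) (x : T) : proj T i x ∈ Grc T i :=
  (DirectSum.decompose (Grc T) x i).2

theorem proj_of_mem {i : ℕ} {x : T} (hx : x ∈ Grc T i) : proj T i x = x :=
  DirectSum.decompose_of_mem_same _ hx

theorem proj_of_mem_ne {i j : ℕ} {x : T} (hx : x ∈ Grc T j) (hij : i ≠ j) : proj T i x = 0 :=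
  DirectSum.decompose_of_mem_ne _ hx hij.symm

theorem mem_span_proj (x : T) : x ∈ Submodule.span ℚ (Set.range fun i => proj T i x) := by
  classical
  have h := Submodule.sum_mem (Submodule.span ℚ (Set.range fun i => proj T i x))
    (t := (DirectSum.decompose (Grc T) x).support) (f := fun i => proj T i x)
    fun i _ => Submodule.subset_span (Set.mem_range_self i)
  rwa [show ∑ i ∈ (DirectSum.decompose (Grc T) x).support, proj T i x = x from
    DirectSum.sum_support_decompose (Grc T) x] at h

theorem iSup_grc : ⨆ i, Grc T i = ⊤ :=
  (DirectSum.Decomposition.isInternal (Grc T)).submodule_iSup_eq_top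

theorem map_proj {f : T →ₐ[ℚ] U} (hf : IsGCAHom f) (i : ℕ) (x : T) :
    f (proj T i x) = proj U i (f x) := by
  have hx : x ∈ ⨆ i, Grc T i := iSup_grc (T := T) ▸ Submodule.mem_top
  induction hx using Submodule.iSup_induction' with
  | mem j x hx =>
    by_cases hij : i = j
    · subst hij
      rw [proj_of_mem hx, proj_of_mem (hf _ _ hx)]
    · rw [proj_of_mem_ne hx hij, proj_of_mem_ne (hf _ _ hx) hij, map_zero]
  | zero => simp
  | add x y _ _ hx hy => simp [hx, hy]

/-- A submodule is homogeneous if it is spanned by its homogeneous elements. -/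
def Homogeneous (V : Submodule ℚ T) : Prop :=
  V ≤ Submodule.span ℚ {x | x ∈ V ∧ ∃ i, x ∈ Grc T i}

theorem homogeneous_of_proj {V : Submodule ℚ T} (h : ∀ x ∈ V, ∀ i, proj T i x ∈ V) :
    Homogeneous V := by
  intro x hx
  refine Submodule.span_mono ?_ (mem_span_proj x)
  rintro _ ⟨i, rfl⟩
  exact ⟨h x hx i, i, proj_mem i x⟩

theorem Homogeneous.proj_mem {V : Submodule ℚ T} (h : Homogeneous V) {x : T} (hx : x ∈ V)
    (i : ℕ) : proj T i x ∈ V := by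
  have : V ≤ V.comap (proj T i) := by
    refine h.trans (Submodule.span_le.2 ?_)
    rintro y ⟨hy, j, hj⟩
    change proj T i y ∈ V
    by_cases hij : i = j
    · subst hij
      rwa [proj_of_mem hj]
    · rw [proj_of_mem_ne hj hij]
      exact V.zero_mem
  exact this hx

theorem homogeneous_top : Homogeneous (⊤ : Submodule ℚ T) :=
  homogeneous_of_proj fun _ _ _ => Submodule.mem_top

theorem homogeneous_ker {f : T →ₐ[ℚ] U} (hf : IsGCAHom f) :
    Homogeneous (LinearMap.ker f.toLinearMap) := by
  refine homogeneous_of_proj fun x hx i => ?_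
  have hx : f x = 0 := hx
  change f (proj T i x) = 0
  rw [map_proj hf, hx, map_zero]

theorem Homogeneous.map {V : Submodule ℚ T} (hV : Homogeneous V) {f : T →ₐ[ℚ] U}
    (hf : IsGCAHom f) : Homogeneous (V.map f.toLinearMap) := by
  refine (Submodule.map_mono hV).trans ?_
  rw [Submodule.map_span]
  refine Submodule.span_mono ?_
  rintro _ ⟨x, ⟨hx, i, hi⟩, rfl⟩
  exact ⟨Submodule.mem_map_of_mem hx, i, hf i x hi⟩

theorem Homogeneous.mul {V W : Submodule ℚ T} (hV : Homogeneous V) (hW : Homogeneous W) :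
    Homogeneous (V * W) := by
  refine (mul_le_mul' hV hW).trans ?_
  rw [Submodule.span_mul_span]
  refine Submodule.span_mono ?_
  rintro _ ⟨x, ⟨hx, i, hi⟩, y, ⟨hy, j, hj⟩, rfl⟩
  exact ⟨Submodule.mul_mem_mul hx hy, i + j, SetLike.mul_mem_graded hi hj⟩

theorem Homogeneous.sup {V W : Submodule ℚ T} (hV : Homogeneous V) (hW : Homogeneous W) :
    Homogeneous (V ⊔ W) :=
  sup_le (hV.trans (Submodule.span_mono fun _ hx => ⟨Submodule.mem_sup_left hx.1, hx.2⟩))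
    (hW.trans (Submodule.span_mono fun _ hx => ⟨Submodule.mem_sup_right hx.1, hx.2⟩))

theorem Homogeneous.mul_le {V W : Submodule ℚ T} (hV : Homogeneous V) (hW : Homogeneous W) :
    V * W ≤ W * V := by
  refine (mul_le_mul' hV hW).trans ?_
  rw [Submodule.span_mul_span, Submodule.span_le]
  rintro _ ⟨x, ⟨hx, i, hi⟩, y, ⟨hy, j, hj⟩, rfl⟩
  change x * y ∈ W * V
  rw [GCA.grading_comm i j x y hi hj]
  exact Submodule.smul_mem _ _ (Submodule.mul_mem_mul hy hx)

theorem Homogeneous.mul_comm {V W : Submodule ℚ T} (hV : Homogeneous V) (hW : Homogeneous W) :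
    V * W = W * V :=
  le_antisymm (hV.mul_le hW) (hW.mul_le hV)

/-- A graded-commutative algebra structure from a spanning family of submodules which is
compatible with the multiplication and separated by a family of projections. -/
abbrev GCA.ofProj {D : Type} [Ring D] [Algebra ℚ D] (V : ℕ → Submodule ℚ D)
    (one_mem : 1 ∈ V 0)
    (mul_mem : ∀ (i j : ℕ) (a b : D), a ∈ V i → b ∈ V j → a * b ∈ V (i + j))
    (comm : ∀ (i j : ℕ) (a b : D), a ∈ V i → b ∈ V j →
      a * b = ((-1 : ℚ) ^ (i * j)) • (b * a))
    (top_le : ⊤ ≤ ⨆ i, V i) (p : ℕ → D →ₗ[ℚ] D)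
    (p_same : ∀ i, ∀ x ∈ V i, p i x = x)
    (p_ne : ∀ i j, i ≠ j → ∀ x ∈ V j, p i x = 0) : GCA D where
  grading := V
  gradedAlgebra :=
    { one_mem := one_mem
      mul_mem := fun {i j a b} ha hb => mul_mem i j a b ha hb
      toDecomposition := by
        refine (DirectSum.isInternal_submodule_of_iSupIndep_of_iSup_eq_top ?_
          (top_le_iff.1 top_le)).chooseDecomposition
        intro i
        rw [Submodule.disjoint_def]
        intro x hx hx'
        have hle : ⨆ j, ⨆ (_ : j ≠ i), V j ≤ LinearMap.ker (p i) :=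
          iSup₂_le fun j hj y hy => p_ne i j hj.symm y hy
        rw [← p_same i x hx]
        exact hle hx' }
  grading_comm := comm

/-- A homogeneous subalgebra of a graded-commutative algebra is graded-commutative. -/
abbrev GCA.subalgebra (S : Subalgebra ℚ T) (hS : Homogeneous (Subalgebra.toSubmodule S)) :
    GCA S :=
  GCA.ofProj (fun i => (Grc T i).comap S.val.toLinearMap)
    (SetLike.GradedOne.one_mem (A := Grc T))
    (fun i j a b ha hb => SetLike.mul_mem_graded (A := Grc T) (i := i) (j := j) ha hb)
    (fun i j a b ha hb => Subtype.ext (GCA.grading_comm i j (a : T) (b : T) ha hb))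
    (by
      intro x _
      have key : Subalgebra.toSubmodule S ≤
          (⨆ i, (Grc T i).comap S.val.toLinearMap).map S.val.toLinearMap := by
        refine hS.trans (Submodule.span_le.2 ?_)
        rintro y ⟨hy, i, hi⟩
        exact ⟨⟨y, hy⟩, Submodule.mem_iSup_of_mem i hi, rfl⟩
      obtain ⟨y, hy, hyx⟩ := key x.2
      rwa [← show y = x from Subtype.ext hyx])
    (fun i => (proj T i).restrict (p := Subalgebra.toSubmodule S) (q := Subalgebra.toSubmodule S)
      fun _ hx => hS.proj_mem hx i)
    (fun _ _ hx => Subtype.ext (proj_of_mem hx))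
    (fun _ _ hij _ hx => Subtype.ext (proj_of_mem_ne hx hij))

/-- The quotient of a graded-commutative algebra by a homogeneous two-sided ideal is
graded-commutative. -/
abbrev GCA.quotient (I : Ideal T) [I.IsTwoSided] (hI : Homogeneous (I.restrictScalars ℚ)) :
    GCA (T ⧸ I) :=
  GCA.ofProj (fun i => (Grc T i).map (Ideal.Quotient.mkₐ ℚ I).toLinearMap)
    ⟨1, SetLike.GradedOne.one_mem (A := Grc T), map_one (Ideal.Quotient.mkₐ ℚ I)⟩
    (by
      rintro i j _ _ ⟨a, ha, rfl⟩ ⟨b, hb, rfl⟩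
      exact ⟨a * b, SetLike.mul_mem_graded ha hb, map_mul (Ideal.Quotient.mkₐ ℚ I) a b⟩)
    (by
      rintro i j _ _ ⟨a, ha, rfl⟩ ⟨b, hb, rfl⟩
      have h := congrArg (Ideal.Quotient.mkₐ ℚ I) (GCA.grading_comm i j a b ha hb)
      rwa [map_smul, map_mul, map_mul] at h)
    (by
      rw [← Submodule.map_iSup, iSup_grc, Submodule.map_top, LinearMap.range_eq_top.2]
      exact Ideal.Quotient.mkₐ_surjective ℚ I)
    (fun i => (Submodule.mapQ (I.restrictScalars ℚ) (I.restrictScalars ℚ) (proj T i)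
      fun _ hx => hI.proj_mem hx i))
    (by
      rintro i _ ⟨x, hx, rfl⟩
      exact congrArg (Ideal.Quotient.mkₐ ℚ I) (proj_of_mem hx))
    (by
      rintro i j hij _ ⟨x, hx, rfl⟩
      exact (congrArg (Ideal.Quotient.mkₐ ℚ I) (proj_of_mem_ne hx hij)).trans
        (map_zero (Ideal.Quotient.mkₐ ℚ I)))

end Grading

theorem IsGCAHom.comp {A B C : Type} [GCA A] [GCA B] [GCA C] {g : B →ₐ[ℚ] C} {f : A →ₐ[ℚ] B}
    (hg : IsGCAHom g) (hf : IsGCAHom f) : IsGCAHom (g.comp f) :=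
  fun i a ha => hg i _ (hf i a ha)

theorem GCACoprod.hom_ext {A B C D : Type} [GCA A] [GCA B] [GCA C] [GCA D]
    (cop : GCACoprod A B C) {f g : C →ₐ[ℚ] D} (hf : IsGCAHom f) (hg : IsGCAHom g)
    (hl : f.comp cop.inl = g.comp cop.inl) (hr : f.comp cop.inr = g.comp cop.inr) : f = g :=
  (cop.coprod D _ _ (hg.comp cop.inl_hom) (hg.comp cop.inr_hom)).unique
    ⟨hf, hl, hr⟩ ⟨hg, rfl, rfl⟩

namespace GTensorPower

variable {A T : Type} [GCA A] [GCA T] {r : ℕ}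

theorem hom_ext {D : Type} [GCA D] (P : GTensorPower A r T) {f g : T →ₐ[ℚ] D}
    (hf : IsGCAHom f) (hg : IsGCAHom g) (h : ∀ k, f.comp (P.ι k) = g.comp (P.ι k)) : f = g :=
  (P.coprod D _ fun k => hg.comp (P.ι_hom k)).unique ⟨hf, h⟩ ⟨hg, fun _ => rfl⟩

theorem mu_hom (P : GTensorPower A r T) : IsGCAHom P.mu :=
  (P.coprod A (fun _ => AlgHom.id ℚ A) (fun _ => isGCAHom_id A)).choose_spec.1.1

theorem mu_comp_ι (P : GTensorPower A r T) (k : Fin r) : P.mu.comp (P.ι k) = AlgHom.id ℚ A :=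
  (P.coprod A (fun _ => AlgHom.id ℚ A) (fun _ => isGCAHom_id A)).choose_spec.1.2 k

theorem mu_ι (P : GTensorPower A r T) (k : Fin r) (a : A) : P.mu (P.ι k a) = a :=
  DFunLike.congr_fun (P.mu_comp_ι k) a

theorem ι_sub_ι_mem_ker (P : GTensorPower A r T) (k l : Fin r) (a : A) :
    P.ι k a - P.ι l a ∈ LinearMap.ker P.mu.toLinearMap := by
  change P.mu (P.ι k a - P.ι l a) = 0
  rw [map_sub, mu_ι, mu_ι, sub_self]

theorem mu_comp {B S : Type} [GCA B] [GCA S] (P : GTensorPower A r T)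
    (Q : GTensorPower B r S) {f : A →ₐ[ℚ] B} (hf : IsGCAHom f) {j : T →ₐ[ℚ] S}
    (hj : IsGCAHom j) (h : ∀ k, j.comp (P.ι k) = (Q.ι k).comp f) :
    Q.mu.comp j = f.comp P.mu := by
  refine P.hom_ext (Q.mu_hom.comp hj) (hf.comp P.mu_hom) fun k => ?_
  rw [AlgHom.comp_assoc, h, ← AlgHom.comp_assoc, mu_comp_ι, AlgHom.comp_assoc, mu_comp_ι]
  rfl

theorem map_ker_le_ker {B S : Type} [GCA B] [GCA S] (P : GTensorPower A r T)
    (Q : GTensorPower B r S) {f : A →ₐ[ℚ] B} (hf : IsGCAHom f) {j : T →ₐ[ℚ] S}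
    (hj : IsGCAHom j) (h : ∀ k, j.comp (P.ι k) = (Q.ι k).comp f) :
    (LinearMap.ker P.mu.toLinearMap).map j.toLinearMap ≤ LinearMap.ker Q.mu.toLinearMap := by
  rintro _ ⟨x, hx, rfl⟩
  have hx : P.mu x = 0 := hx
  have := DFunLike.congr_fun (P.mu_comp Q hf hj h) x
  exact this.trans (by simp [hx])

/-- A homogeneous subalgebra containing the image of every coproduct inclusion is everything. -/
theorem eq_top_of_ι_mem {B C : Type} [GCA B] [GCA C] (cop : GCACoprod A B C)
    (P : GTensorPower C r T) (S : Subalgebra ℚ T) (hS : Homogeneous (Subalgebra.toSubmodule S))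
    (hl : ∀ k a, P.ι k (cop.inl a) ∈ S) (hr : ∀ k b, P.ι k (cop.inr b) ∈ S) : S = ⊤ := by
  let _ : GCA S := GCA.subalgebra S hS
  have hval : IsGCAHom S.val := fun _ _ h => h
  have hfactor (k : Fin r) : ∃ g : C →ₐ[ℚ] S, IsGCAHom g ∧ S.val.comp g = P.ι k := by
    obtain ⟨g, ⟨hg, hgl, hgr⟩, -⟩ := cop.coprod S
      (((P.ι k).comp cop.inl).codRestrict S (hl k)) (((P.ι k).comp cop.inr).codRestrict S (hr k))
      ((P.ι_hom k).comp cop.inl_hom) ((P.ι_hom k).comp cop.inr_hom)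
    refine ⟨g, hg, cop.hom_ext (hval.comp hg) (P.ι_hom k) ?_ ?_⟩
    · rw [AlgHom.comp_assoc, hgl]
      rfl
    · rw [AlgHom.comp_assoc, hgr]
      rfl
  choose g hg hgι using hfactor
  obtain ⟨G, ⟨hG, hGι⟩, -⟩ := P.coprod S g hg
  have hid : S.val.comp G = AlgHom.id ℚ T := by
    refine P.hom_ext (hval.comp hG) (isGCAHom_id T) fun k => ?_
    rw [AlgHom.comp_assoc, hGι, hgι]
    rfl
  refine top_le_iff.1 fun x _ => ?_
  rw [show x = S.val (G x) from (DFunLike.congr_fun hid x).symm]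
  exact (G x).2

/-- A homogeneous two-sided ideal identifying all the inclusions of the summands contains the
kernel of the multiplication. -/
theorem ker_mu_le {B C : Type} [GCA B] [GCA C] (cop : GCACoprod A B C)
    (P : GTensorPower C r T) (I : Ideal T) [I.IsTwoSided]
    (hI : Homogeneous (I.restrictScalars ℚ)) (k₀ : Fin r)
    (hl : ∀ k a, P.ι k (cop.inl a) - P.ι k₀ (cop.inl a) ∈ I)
    (hr : ∀ k b, P.ι k (cop.inr b) - P.ι k₀ (cop.inr b) ∈ I) :
    LinearMap.ker P.mu.toLinearMap ≤ I.restrictScalars ℚ := by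
  let _ : GCA (T ⧸ I) := GCA.quotient I hI
  let q : T →ₐ[ℚ] T ⧸ I := Ideal.Quotient.mkₐ ℚ I
  have hq : IsGCAHom q := fun i a ha => Submodule.mem_map_of_mem ha
  have hqι (k : Fin r) : q.comp (P.ι k) = q.comp (P.ι k₀) := by
    refine cop.hom_ext (hq.comp (P.ι_hom k)) (hq.comp (P.ι_hom k₀)) ?_ ?_
    · exact AlgHom.ext fun a => Ideal.Quotient.eq.2 (hl k a)
    · exact AlgHom.ext fun b => Ideal.Quotient.eq.2 (hr k b)
  have hfac : (q.comp (P.ι k₀)).comp P.mu = q := by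
    refine P.hom_ext ((hq.comp (P.ι_hom k₀)).comp P.mu_hom) hq fun k => ?_
    rw [AlgHom.comp_assoc, mu_comp_ι, hqι k]
    rfl
  intro x hx
  have hx : P.mu x = 0 := hx
  refine Ideal.Quotient.eq_zero_iff_mem.1 ?_
  change q x = 0
  rw [← hfac, AlgHom.comp_apply, hx, map_zero]

end GTensorPower

theorem map_top_mul_map_top {T U : Type} [GCA T] [GCA U] (f : T →ₐ[ℚ] U) :
    Submodule.map f.toLinearMap ⊤ * Submodule.map f.toLinearMap ⊤ ≤
      Submodule.map f.toLinearMap ⊤ := by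
  rw [← Submodule.map_mul]
  exact Submodule.map_mono le_top

theorem map_ker_mul_map_top {T U V : Type} [GCA T] [GCA U] [GCA V] (f : T →ₐ[ℚ] U)
    (g : T →ₐ[ℚ] V) :
    Submodule.map f.toLinearMap (LinearMap.ker g.toLinearMap) * Submodule.map f.toLinearMap ⊤ ≤
      Submodule.map f.toLinearMap (LinearMap.ker g.toLinearMap) := by
  rw [← Submodule.map_mul]
  refine Submodule.map_mono (Submodule.mul_le.2 fun x hx y _ => ?_)
  have hx : g x = 0 := hx
  change g (x * y) = 0
  rw [map_mul, hx, zero_mul]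

/-- For graded-commutative algebras `A`, `B` of finite type
over `ℚ` and `r ≥ 2`, the kernel of the `r`-fold multiplication of the graded
tensor product `A ⊗ B` satisfies
`ker μ^r_{A⊗B} = (ker μ^r_A) ⊗ B^{⊗r} + A^{⊗r} ⊗ (ker μ^r_B)`, where
`(A⊗B)^{⊗r}` is identified with `A^{⊗r} ⊗ B^{⊗r}` via the morphisms
`jA : A^{⊗r} → (A⊗B)^{⊗r}` and `jB : B^{⊗r} → (A⊗B)^{⊗r}` induced by
`inl : A → A⊗B` and `inr : B → A⊗B`. -/
theorem ker_mu_graded_tensor (A B C : Type) [GCA A] [GCA B] [GCA C]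
    (hA : FiniteType A) (hB : FiniteType B) (cop : GCACoprod A B C)
    (r : ℕ) (hr : 2 ≤ r)
    (TA TB TAB : Type) [GCA TA] [GCA TB] [GCA TAB]
    (PA : GTensorPower A r TA) (PB : GTensorPower B r TB)
    (PC : GTensorPower C r TAB)
    (jA : TA →ₐ[ℚ] TAB) (jB : TB →ₐ[ℚ] TAB)
    (hjA : IsGCAHom jA) (hjB : IsGCAHom jB)
    (hjAι : ∀ k, jA.comp (PA.ι k) = (PC.ι k).comp cop.inl)
    (hjBι : ∀ k, jB.comp (PB.ι k) = (PC.ι k).comp cop.inr) :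
    LinearMap.ker PC.mu.toLinearMap =
      Submodule.map jA.toLinearMap (LinearMap.ker PA.mu.toLinearMap) *
          Submodule.map jB.toLinearMap ⊤ ⊔
        Submodule.map jA.toLinearMap ⊤ *
          Submodule.map jB.toLinearMap (LinearMap.ker PB.mu.toLinearMap) := by
  let k₀ : Fin r := ⟨0, by omega⟩
  set a := Submodule.map jA.toLinearMap ⊤
  set b := Submodule.map jB.toLinearMap ⊤
  set I := Submodule.map jA.toLinearMap (LinearMap.ker PA.mu.toLinearMap)
  set J := Submodule.map jB.toLinearMap (LinearMap.ker PB.mu.toLinearMap)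
  have homa : Homogeneous a := homogeneous_top.map hjA
  have homb : Homogeneous b := homogeneous_top.map hjB
  have homI : Homogeneous I := (homogeneous_ker PA.mu_hom).map hjA
  have homJ : Homogeneous J := (homogeneous_ker PB.mu_hom).map hjB
  have haa : a * a ≤ a := map_top_mul_map_top jA
  have hbb : b * b ≤ b := map_top_mul_map_top jB
  have hIa : I * a ≤ I := map_ker_mul_map_top jA PA.mu
  have hJb : J * b ≤ J := map_ker_mul_map_top jB PB.mu
  have h1a : (1 : TAB) ∈ a := ⟨1, Submodule.mem_top, map_one jA⟩
  have h1b : (1 : TAB) ∈ b := ⟨1, Submodule.mem_top, map_one jB⟩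
  have hab_mul : a * b * (a * b) ≤ a * b := calc
    a * b * (a * b) = a * (b * a) * b := by simp only [mul_assoc]
    _ = a * a * (b * b) := by rw [homb.mul_comm homa]; simp only [mul_assoc]
    _ ≤ a * b := mul_le_mul' haa hbb
  have hιA (k : Fin r) (x : A) : PC.ι k (cop.inl x) = jA (PA.ι k x) :=
    (DFunLike.congr_fun (hjAι k) x).symm
  have hιB (k : Fin r) (x : B) : PC.ι k (cop.inr x) = jB (PB.ι k x) :=
    (DFunLike.congr_fun (hjBι k) x).symm
  have hab : a * b = ⊤ := by
    let S : Subalgebra ℚ TAB := (a * b).toSubalgebra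
      (by simpa using Submodule.mul_mem_mul h1a h1b)
      fun x y hx hy => hab_mul (Submodule.mul_mem_mul hx hy)
    have hS : S = ⊤ := by
      refine PC.eq_top_of_ι_mem cop S (homa.mul homb) (fun k x => ?_) fun k x => ?_
      · rw [hιA, ← mul_one (jA _)]
        exact Submodule.mul_mem_mul ⟨_, Submodule.mem_top, rfl⟩ h1b
      · rw [hιB, ← one_mul (jB _)]
        exact Submodule.mul_mem_mul h1a ⟨_, Submodule.mem_top, rfl⟩
    exact congrArg Subalgebra.toSubmodule hS
  have hright : (I * b ⊔ a * J) * ⊤ ≤ I * b ⊔ a * J := by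
    rw [← hab, Submodule.sup_mul]
    refine sup_le_sup ?_ ?_
    · calc
        I * b * (a * b) = I * (b * a) * b := by simp only [mul_assoc]
        _ = I * a * (b * b) := by rw [homb.mul_comm homa]; simp only [mul_assoc]
        _ ≤ I * b := mul_le_mul' hIa hbb
    · calc
        a * J * (a * b) = a * (J * a) * b := by simp only [mul_assoc]
        _ = a * a * (J * b) := by rw [homJ.mul_comm homa]; simp only [mul_assoc]
        _ ≤ a * J := mul_le_mul' haa hJb
  have homK : Homogeneous (I * b ⊔ a * J) := (homI.mul homb).sup (homa.mul homJ)
  have hleft : ⊤ * (I * b ⊔ a * J) ≤ I * b ⊔ a * J :=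
    (homogeneous_top.mul_le homK).trans hright
  apply le_antisymm
  · let K : Ideal TAB :=
      { I * b ⊔ a * J with
        smul_mem' := fun _ _ hx => hleft (Submodule.mul_mem_mul Submodule.mem_top hx) }
    have : K.IsTwoSided :=
      ⟨fun _ hx => hright (Submodule.mul_mem_mul hx Submodule.mem_top)⟩
    refine PC.ker_mu_le cop K homK k₀ (fun k x => ?_) fun k x => ?_
    · rw [hιA, hιA, ← map_sub, ← mul_one (jA _)]
      exact Submodule.mem_sup_left
        (Submodule.mul_mem_mul ⟨_, PA.ι_sub_ι_mem_ker k k₀ x, rfl⟩ h1b)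
    · rw [hιB, hιB, ← map_sub, ← one_mul (jB _)]
      exact Submodule.mem_sup_right
        (Submodule.mul_mem_mul h1a ⟨_, PB.ι_sub_ι_mem_ker k k₀ x, rfl⟩)
  · refine sup_le (Submodule.mul_le.2 fun x hx y _ => ?_) (Submodule.mul_le.2 fun x _ y hy => ?_)
    · have hx : PC.mu x = 0 := PA.map_ker_le_ker PC cop.inl_hom hjA hjAι hx
      change PC.mu (x * y) = 0
      rw [map_mul, hx, zero_mul]
    · have hy : PC.mu y = 0 := PB.map_ker_le_ker PC cop.inr_hom hjB hjBι hy
      change PC.mu (x * y) = 0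
      rw [map_mul, hy, mul_zero]

end RHT
end
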